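/- arXiv:2012.01685 — 2 statements merged into one kernel-verified Lean document; each statement's English description precedes it below -/
import Mathlib

section
/- (Matched-loss influence, Koh–Liang formula as a special case.) Let E be a finite-dimensional real inner product space, let R : E → ℝ (the empirical training risk) and ℓ : E → ℝ (the training loss of a sample z) be differentiable, and let θ : ℝ → E be differentiable at 0 with θ(0) = θ̂. Assume: (i) the gradient map ∇R : E → E is differentiable at θ̂ with Fréchet derivative the invertible continuous linear map H : E → E (the Hessian of R at θ̂); (ii) the gradient map ∇ℓ : E → E is continuous at θ̂; (iii) for all ε in some neighborhood of 0, ∇R(θ(ε)) + ε·∇ℓ(θ(ε)) = 0. Then for any function g : E → ℝ differentiable at θ̂, in particular for g = ℓ itself, one has d/dε ℓ(θ(ε)) |_{ε=0} = −⟨∇ℓ(θ̂), H⁻¹(∇ℓ(θ̂))⟩. -/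
open scoped RealInnerProductSpace

/-- The map `t ↦ t • f t` is differentiable at `0` as soon as `f` is continuous there. -/
theorem hasDerivAt_id_smul_zero {E : Type*} [NormedAddCommGroup E] [NormedSpace ℝ E]
    {f : ℝ → E} (hf : ContinuousAt f 0) : HasDerivAt (fun t => t • f t) (f 0) 0 := by
  rw [hasDerivAt_iff_tendsto_slope_zero]
  refine (hf.tendsto.mono_left nhdsWithin_le_nhds).congr' ?_
  filter_upwards [self_mem_nhdsWithin] with t ht
  simp [inv_smul_smul₀ (show t ≠ 0 from ht)]

/-- Implicit differentiation of the stationarity condition: the velocity at `0` of a curve of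
zeros of `G + t • F` is `-H⁻¹ (F (θ 0))`, where `H` is the derivative of `G` at `θ 0`. -/
theorem hasDerivAt_of_eventually_add_smul_eq_zero {E : Type*} [NormedAddCommGroup E]
    [NormedSpace ℝ E] {G F : E → E} {θ : ℝ → E} {H : E ≃L[ℝ] E}
    (hθ : DifferentiableAt ℝ θ 0) (hG : HasFDerivAt G (H : E →L[ℝ] E) (θ 0))
    (hF : ContinuousAt F (θ 0)) (hstat : ∀ᶠ t in nhds (0 : ℝ), G (θ t) + t • F (θ t) = 0) :
    HasDerivAt θ (-H.symm (F (θ 0))) 0 := by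
  have hsum := (hG.comp_hasDerivAt 0 hθ.hasDerivAt).add
    (hasDerivAt_id_smul_zero (f := fun t => F (θ t)) (hF.comp hθ.continuousAt))
  have hzero : H (deriv θ 0) + F (θ 0) = 0 :=
    hsum.unique ((hasDerivAt_const (0 : ℝ) (0 : E)).congr_of_eventuallyEq hstat)
  have hderiv : deriv θ 0 = -H.symm (F (θ 0)) := by
    rw [← map_neg, ← eq_neg_of_add_eq_zero_left hzero, H.symm_apply_apply]
  exact hderiv ▸ hθ.hasDerivAt

/-- Matched-loss influence (Koh–Liang formula, Equations (1)/(4)): with the same loss `ℓ`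
used at training and test time, the self-influence of the sample `z` is
`d/dε ℓ(θ(ε)) |_{ε=0} = −⟨∇ℓ(θ̂), H⁻¹ ∇ℓ(θ̂)⟩`. -/
theorem matched_loss_influence
    {E : Type*} [NormedAddCommGroup E] [InnerProductSpace ℝ E] [FiniteDimensional ℝ E]
    (θhat : E) (R ℓ : E → ℝ) (θ : ℝ → E) (H : E ≃L[ℝ] E)
    (hR : Differentiable ℝ R) (hℓ : Differentiable ℝ ℓ)
    (hθ : DifferentiableAt ℝ θ 0) (hθ0 : θ 0 = θhat)
    (hH : HasFDerivAt (gradient R) (H : E →L[ℝ] E) θhat)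
    (hgradcont : ContinuousAt (gradient ℓ) θhat)
    (hstat : ∀ᶠ ε in nhds (0 : ℝ), gradient R (θ ε) + ε • gradient ℓ (θ ε) = 0) :
    HasDerivAt (fun ε => ℓ (θ ε))
      (-⟪gradient ℓ θhat, H.symm (gradient ℓ θhat)⟫) 0 := by
  subst hθ0
  have hvel := hasDerivAt_of_eventually_add_smul_eq_zero hθ hH hgradcont hstat
  have hcomp := (hℓ (θ 0)).hasGradientAt.hasFDerivAt.comp_hasDerivAt 0 hvel
  simpa [Function.comp_def] using hcomp
end

section
/- (Sign of the self-influence at a nondegenerate minimum.) Let E be a finite-dimensional real inner product space, let R : E → ℝ and ℓ : E → ℝ be differentiable, and let θ : ℝ → E be differentiable at 0 with θ(0) = θ̂. Assume: (i) the gradient map ∇R : E → E is differentiable at θ̂ with Fréchet derivative the continuous linear map H : E → E, and H is self-adjoint and positive definite (so in particular invertible); (ii) the gradient map ∇ℓ : E → E is continuous at θ̂; (iii) for all ε in some neighborhood of 0, ∇R(θ(ε)) + ε·∇ℓ(θ(ε)) = 0; (iv) ∇ℓ(θ̂) ≠ 0. Then d/dε ℓ(θ(ε)) |_{ε=0} =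 −⟨∇ℓ(θ̂), H⁻¹(∇ℓ(θ̂))⟩ < 0; that is, upweighting the training sample z strictly decreases its own loss to first order. -/
open scoped RealInnerProductSpace

/-- If `g` is continuous at `0`, then `ε ↦ ε • g ε` has derivative `g 0` at `0`. -/
theorem hasDerivAt_id_smul_zero_of_continuousAt
    {F : Type*} [NormedAddCommGroup F] [NormedSpace ℝ F] {g : ℝ → F} (hg : ContinuousAt g 0) :
    HasDerivAt (fun ε => ε • g ε) (g 0) 0 := by
  rw [hasDerivAt_iff_tendsto_slope_zero]
  refine (hg.tendsto.mono_left nhdsWithin_le_nhds).congr' ?_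
  filter_upwards [self_mem_nhdsWithin] with t ht
  simp [smul_smul, inv_mul_cancel₀ (show t ≠ 0 from ht)]

/-- First-order response of a curve of perturbed stationary points: if
`G (θ ε) + ε • g (θ ε) = 0` near `0` and `G` has invertible derivative `H` at `θ 0`,
then `θ' = -H⁻¹ (g (θ 0))`. -/
theorem HasDerivAt.eq_neg_symm_of_perturbed_stationary
    {F : Type*} [NormedAddCommGroup F] [NormedSpace ℝ F] {G g : F → F} {θ : ℝ → F} {v : F}
    {H : F ≃L[ℝ] F} (hθ : HasDerivAt θ v 0) (hG : HasFDerivAt G (H : F →L[ℝ] F) (θ 0))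
    (hg : ContinuousAt g (θ 0)) (hstat : ∀ᶠ ε in nhds (0 : ℝ), G (θ ε) + ε • g (θ ε) = 0) :
    v = -H.symm (g (θ 0)) := by
  have hsum : HasDerivAt (fun ε => G (θ ε) + ε • g (θ ε)) (H v + g (θ 0)) 0 :=
    (hG.comp_hasDerivAt 0 hθ).add
      (hasDerivAt_id_smul_zero_of_continuousAt (g := fun ε => g (θ ε))
        (hg.comp hθ.continuousAt))
  have hzero : HasDerivAt (fun ε => G (θ ε) + ε • g (θ ε)) 0 0 :=
    (hasDerivAt_const (0 : ℝ) (0 : F)).congr_of_eventuallyEq hstat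
  rw [← map_neg, ← eq_neg_of_add_eq_zero_left (hsum.unique hzero), H.symm_apply_apply]

/-- Sign of the self-influence at a nondegenerate minimum: when the Hessian `H` of the
training risk at `θ̂` is self-adjoint and positive definite and `∇ℓ(θ̂) ≠ 0`, the
self-influence `d/dε ℓ(θ(ε)) |_{ε=0} = −⟨∇ℓ(θ̂), H⁻¹ ∇ℓ(θ̂)⟩` is strictly negative. -/
theorem self_influence_neg_at_nondegenerate_min
    {E : Type*} [NormedAddCommGroup E] [InnerProductSpace ℝ E] [FiniteDimensional ℝ E]
    (θhat : E) (R ℓ : E → ℝ) (θ : ℝ → E) (H : E ≃L[ℝ] E)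
    (hR : Differentiable ℝ R) (hℓ : Differentiable ℝ ℓ)
    (hθ : DifferentiableAt ℝ θ 0) (hθ0 : θ 0 = θhat)
    (hH : HasFDerivAt (gradient R) (H : E →L[ℝ] E) θhat)
    (hsa : ∀ x y : E, ⟪H x, y⟫ = ⟪x, H y⟫)
    (hpd : ∀ x : E, x ≠ 0 → 0 < ⟪H x, x⟫)
    (hgradcont : ContinuousAt (gradient ℓ) θhat)
    (hstat : ∀ᶠ ε in nhds (0 : ℝ), gradient R (θ ε) + ε • gradient ℓ (θ ε) = 0)
    (hne : gradient ℓ θhat ≠ 0) :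
    HasDerivAt (fun ε => ℓ (θ ε))
        (-⟪gradient ℓ θhat, H.symm (gradient ℓ θhat)⟫) 0 ∧
      -⟪gradient ℓ θhat, H.symm (gradient ℓ θhat)⟫ < 0 := by
  subst hθ0
  have hderiv := hθ.hasDerivAt.eq_neg_symm_of_perturbed_stationary hH hgradcont hstat
  constructor
  · have hcomp := (hℓ (θ 0)).hasFDerivAt.comp_hasDerivAt 0 hθ.hasDerivAt
    rwa [← inner_gradient_left, hderiv, inner_neg_right] at hcomp
  · have hpos := hpd (H.symm (gradient ℓ (θ 0))) (by simpa using hne)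
    rw [H.apply_symm_apply] at hpos
    exact neg_neg_of_pos hpos
end
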